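/- For all 1-forms μ, ν on ℝ⁶ (identified with vectors via the metric): ⟨μ∧Ψ₊, ν∧Ψ₊⟩ = ⟨μ∧Ψ₋, ν∧Ψ₋⟩ = 2⟨μ,ν⟩ and ⟨μ∧Ψ₋, ν∧Ψ₊⟩ = −2⟨Jμ, ν⟩, where Jμ denotes the 1-form dual to J applied to the vector dual to μ, and the inner products on the left are those of 4-forms. (Pointwise, Hodge-star-free form of the identities ∗(∗(μ∧Ψ±)∧Ψ±) = −2μ and ∗(∗(μ∧Ψ₋)∧Ψ₊) = −∗(∗(μ∧Ψ₊)∧Ψ₋) = 2Jμ.) -/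

import Mathlib

open scoped BigOperators RealInnerProductSpace

noncomputable section

abbrev Form (n p : ℕ) := (Fin p → EuclideanSpace ℝ (Fin n)) → ℝ

namespace Form

/-- Wedge product of forms (shuffle convention; full antisymmetrization divided by p!q!). -/
def wedge {n p q : ℕ} (α : Form n p) (β : Form n q) : Form n (p + q) :=
  fun x =>
    (((p.factorial * q.factorial : ℕ) : ℝ))⁻¹ *
      ∑ σ : Equiv.Perm (Fin (p + q)),
        ((Equiv.Perm.sign σ : ℤ) : ℝ) *
          (α fun i => x (σ (Fin.castAdd q i))) * (β fun j => x (σ (Fin.natAdd p j)))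

/-- Inner product of `p`-forms. -/
def inner' {n p : ℕ} (α β : Form n p) : ℝ :=
  ((p.factorial : ℕ) : ℝ)⁻¹ *
    ∑ f : Fin p → Fin n,
      (α fun k => EuclideanSpace.single (f k) 1) * (β fun k => EuclideanSpace.single (f k) 1)

/-- Interior product of a vector and a form. -/
def iprod {n p : ℕ} (v : EuclideanSpace ℝ (Fin n)) (α : Form n (p + 1)) : Form n p :=
  fun x => α (Fin.cons v x)

end Form

infixl:72 " ⋏ " => Form.wedge

/-- The 1-form dual to a vector. -/
def dual {n : ℕ} (v : EuclideanSpace ℝ (Fin n)) : Form n 1 := fun x => ⟪v, x 0⟫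


abbrev E6 := EuclideanSpace ℝ (Fin 6)

/-- The orthonormal basis `e₁,e₂,e₃,Je₁,Je₂,Je₃` of ℝ⁶. -/
def f6 (i : Fin 6) : E6 := EuclideanSpace.single i 1

/-- The orthogonal complex structure `J` with `J(e_i) = Je_i`, `J(Je_i) = −e_i`. -/
def J6 (x : E6) : E6 :=
  ∑ i : Fin 6, ⟪f6 i, x⟫ • ![f6 3, f6 4, f6 5, -f6 0, -f6 1, -f6 2] i

/-- The Kähler form `ω = −e₁∧Je₁ − e₂∧Je₂ − e₃∧Je₃`. -/
def ω6 : Form 6 2 := fun x =>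
  -(dual (f6 0) ⋏ dual (f6 3)) x - (dual (f6 1) ⋏ dual (f6 4)) x - (dual (f6 2) ⋏ dual (f6 5)) x

/-- `Ψ₊ = e₁∧e₂∧e₃ − Je₁∧Je₂∧e₃ − Je₁∧e₂∧Je₃ − e₁∧Je₂∧Je₃`. -/
def Psip : Form 6 3 := fun x =>
  (dual (f6 0) ⋏ dual (f6 1) ⋏ dual (f6 2)) x - (dual (f6 3) ⋏ dual (f6 4) ⋏ dual (f6 2)) x
    - (dual (f6 3) ⋏ dual (f6 1) ⋏ dual (f6 5)) x - (dual (f6 0) ⋏ dual (f6 4) ⋏ dual (f6 5)) x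

/-- `Ψ₋ = −Je₁∧Je₂∧Je₃ + Je₁∧e₂∧e₃ + e₁∧Je₂∧e₃ + e₁∧e₂∧Je₃`. -/
def Psim : Form 6 3 := fun x =>
  -(dual (f6 3) ⋏ dual (f6 4) ⋏ dual (f6 5)) x + (dual (f6 3) ⋏ dual (f6 1) ⋏ dual (f6 2)) x
    + (dual (f6 0) ⋏ dual (f6 4) ⋏ dual (f6 2)) x + (dual (f6 0) ⋏ dual (f6 1) ⋏ dual (f6 5)) x

/-- `Vol = e₁∧e₂∧e₃∧Je₁∧Je₂∧Je₃`. -/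
def vol6 : Form 6 6 :=
  dual (f6 0) ⋏ dual (f6 1) ⋏ dual (f6 2) ⋏ dual (f6 3) ⋏ dual (f6 4) ⋏ dual (f6 5)

namespace Form

theorem wedge_comp_perm {n p q : ℕ} (α : Form n p) (β : Form n q)
    (x : Fin (p + q) → EuclideanSpace ℝ (Fin n)) (τ : Equiv.Perm (Fin (p + q))) :
    (α ⋏ β) (x ∘ τ) = ((Equiv.Perm.sign τ : ℤ) : ℝ) * (α ⋏ β) x := by
  unfold wedge
  rw [← Equiv.sum_comp (Equiv.mulLeft τ) (fun σ => ((Equiv.Perm.sign σ : ℤ) : ℝ) *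
    (α fun i => x (σ (Fin.castAdd q i))) * (β fun j => x (σ (Fin.natAdd p j)))),
    mul_left_comm]
  congr 1
  rw [Finset.mul_sum]
  refine Finset.sum_congr rfl fun σ _ => ?_
  have h : ((Equiv.Perm.sign τ : ℤ) : ℝ) * ((Equiv.Perm.sign τ : ℤ) : ℝ) = 1 := by
    rcases Int.units_eq_one_or (Equiv.Perm.sign τ) with h | h <;> simp [h]
  simp only [Equiv.coe_mulLeft, Equiv.Perm.sign_mul, Units.val_mul, Int.cast_mul,
    Equiv.Perm.mul_apply, Function.comp_apply, ← mul_assoc, h, one_mul]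

/-- Against an alternating form, a wedge product may be replaced by a multiple of the
plain tensor product. -/
theorem inner'_wedge {n p q : ℕ} (α : Form n p) (β : Form n q) (γ : Form n (p + q))
    (hγ : ∀ x (τ : Equiv.Perm (Fin (p + q))),
      γ (x ∘ τ) = ((Equiv.Perm.sign τ : ℤ) : ℝ) * γ x) :
    inner' (α ⋏ β) γ = (((p.factorial * q.factorial : ℕ) : ℝ))⁻¹ *
      ∑ f : Fin (p + q) → Fin n,
        (α fun i => EuclideanSpace.single (f (Fin.castAdd q i)) 1) *
          (β fun j => EuclideanSpace.single (f (Fin.natAdd p j)) 1) *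
          γ fun k => EuclideanSpace.single (f k) 1 := by
  have key (σ : Equiv.Perm (Fin (p + q))) :
      ∑ f : Fin (p + q) → Fin n, ((Equiv.Perm.sign σ : ℤ) : ℝ) *
          (α fun i => EuclideanSpace.single (f (σ (Fin.castAdd q i))) 1) *
          (β fun j => EuclideanSpace.single (f (σ (Fin.natAdd p j))) 1) *
          (γ fun k => EuclideanSpace.single (f k) 1) =
        ∑ f : Fin (p + q) → Fin n,
          (α fun i => EuclideanSpace.single (f (Fin.castAdd q i)) 1) *
          (β fun j => EuclideanSpace.single (f (Fin.natAdd p j)) 1) *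
          γ fun k => EuclideanSpace.single (f k) 1 := by
    rw [← Equiv.sum_comp (Equiv.arrowCongr σ (Equiv.refl (Fin n))).symm
      (fun f => (α fun i => EuclideanSpace.single (f (Fin.castAdd q i)) 1) *
          (β fun j => EuclideanSpace.single (f (Fin.natAdd p j)) 1) *
          γ fun k => EuclideanSpace.single (f k) 1)]
    refine Finset.sum_congr rfl fun f _ => ?_
    have h := hγ (fun k => EuclideanSpace.single (f k) 1) σ
    simp only [Function.comp_def] at h
    simp only [Equiv.arrowCongr_symm, Equiv.arrowCongr_apply, Function.comp_def, Equiv.symm_symm,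
      Equiv.refl_symm, Equiv.refl_apply, h]
    ring
  have hp : (((p + q).factorial : ℕ) : ℝ) ≠ 0 := by positivity
  simp only [inner', wedge, mul_assoc, Finset.sum_mul, Finset.mul_sum]
  simp only [← Finset.mul_sum]
  rw [Finset.sum_comm]
  simp only [← mul_assoc, key]
  simp [Fintype.card_perm]
  field_simp

end Form

/-- The coordinate function of `e_i ∧ e_j ∧ e_k`. -/
def wedgeCoord (i j k a b c : Fin 6) : ℤ :=
  let δ : Fin 6 → Fin 6 → ℤ := fun x y => if x = y then 1 else 0
  δ i a * (δ j b * δ k c - δ j c * δ k b) - δ i b * (δ j a * δ k c - δ j c * δ k a)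
    + δ i c * (δ j a * δ k b - δ j b * δ k a)

/-- The coordinates of `Psip`. -/
def psipCoord (a b c : Fin 6) : ℤ :=
  wedgeCoord 0 1 2 a b c - wedgeCoord 3 4 2 a b c - wedgeCoord 3 1 5 a b c
    - wedgeCoord 0 4 5 a b c

/-- The coordinates of `Psim`. -/
def psimCoord (a b c : Fin 6) : ℤ :=
  -wedgeCoord 3 4 5 a b c + wedgeCoord 3 1 2 a b c + wedgeCoord 0 4 2 a b c
    + wedgeCoord 0 1 5 a b c

theorem sum_perm_succ {M : Type*} [AddCommMonoid M] {n : ℕ}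
    (F : Equiv.Perm (Fin (n + 1)) → M) :
    ∑ σ, F σ = ∑ i, ∑ τ, F (Equiv.Perm.decomposeFin.symm (i, τ)) := by
  rw [← Equiv.sum_comp Equiv.Perm.decomposeFin.symm, Fintype.sum_prod_type]

theorem decomposeFin_symm_apply_two {n : ℕ} (p : Fin (n + 3)) (τ : Equiv.Perm (Fin (n + 2))) :
    Equiv.Perm.decomposeFin.symm (p, τ) 2 = Equiv.swap 0 p (τ 1).succ :=
  Equiv.Perm.decomposeFin_symm_apply_succ τ p 1

theorem decomposeFin_symm_apply_three {n : ℕ} (p : Fin (n + 4)) (τ : Equiv.Perm (Fin (n + 3))) :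
    Equiv.Perm.decomposeFin.symm (p, τ) 3 = Equiv.swap 0 p (τ 2).succ :=
  Equiv.Perm.decomposeFin_symm_apply_succ τ p 2

theorem sum_fin_succ_arrow {M α : Type*} [AddCommMonoid M] [Fintype α] {n : ℕ}
    (F : (Fin (n + 1) → α) → M) :
    ∑ f, F f = ∑ a, ∑ f : Fin n → α, F (Fin.cons a f) := by
  rw [← Equiv.sum_comp (Fin.consEquiv fun _ => α), Fintype.sum_prod_type]
  rfl

theorem dual_wedge_dual_wedge_dual {n : ℕ} (u v w : EuclideanSpace ℝ (Fin n))
    (x : Fin 3 → EuclideanSpace ℝ (Fin n)) :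
    (dual u ⋏ dual v ⋏ dual w) x =
      ⟪u, x 0⟫ * (⟪v, x 1⟫ * ⟪w, x 2⟫ - ⟪v, x 2⟫ * ⟪w, x 1⟫)
      - ⟪u, x 1⟫ * (⟪v, x 0⟫ * ⟪w, x 2⟫ - ⟪v, x 2⟫ * ⟪w, x 0⟫)
      + ⟪u, x 2⟫ * (⟪v, x 0⟫ * ⟪w, x 1⟫ - ⟪v, x 1⟫ * ⟪w, x 0⟫) := by
  have h2 (y : Fin 2 → EuclideanSpace ℝ (Fin n)) :
      (dual u ⋏ dual v) y = ⟪u, y 0⟫ * ⟪v, y 1⟫ - ⟪u, y 1⟫ * ⟪v, y 0⟫ := by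
    unfold Form.wedge
    simp only [Nat.reduceAdd]
    rw [sum_perm_succ]
    simp [Fin.sum_univ_succ, dual]
    ring
  conv_lhs => unfold Form.wedge
  simp only [Nat.reduceAdd, sum_perm_succ]
  simp [Fin.sum_univ_succ, dual, decomposeFin_symm_apply_two, Equiv.swap_apply_def]
  ring

theorem dual_f6_wedge (i j k : Fin 6) (f : Fin 3 → Fin 6) :
    (dual (f6 i) ⋏ dual (f6 j) ⋏ dual (f6 k)) (fun l => EuclideanSpace.single (f l) 1) =
      (wedgeCoord i j k (f 0) (f 1) (f 2) : ℝ) := by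
  rw [dual_wedge_dual_wedge_dual]
  simp [f6, wedgeCoord, EuclideanSpace.inner_single_left, PiLp.single_apply]

theorem Psip_single (f : Fin 3 → Fin 6) :
    Psip (fun l => EuclideanSpace.single (f l) 1) = (psipCoord (f 0) (f 1) (f 2) : ℝ) := by
  simp [Psip, psipCoord, dual_f6_wedge]

theorem Psim_single (f : Fin 3 → Fin 6) :
    Psim (fun l => EuclideanSpace.single (f l) 1) = (psimCoord (f 0) (f 1) (f 2) : ℝ) := by
  simp [Psim, psimCoord, dual_f6_wedge]

/-- The coordinates of `e_i ∧ ψ` for an alternating `ψ`. -/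
def wedgeBasisCoord (ψ : Fin 6 → Fin 6 → Fin 6 → ℤ) (i a b c d : Fin 6) : ℤ :=
  (if i = a then ψ b c d else 0) - (if i = b then ψ a c d else 0)
    + (if i = c then ψ a b d else 0) - (if i = d then ψ a b c else 0)

theorem dual_wedge_single (ν : E6) (β : Form 6 3) (ψ : Fin 6 → Fin 6 → Fin 6 → ℤ)
    (hβ : ∀ f : Fin 3 → Fin 6,
      β (fun l => EuclideanSpace.single (f l) 1) = (ψ (f 0) (f 1) (f 2) : ℝ))
    (h₁ : ∀ a b c, ψ b a c = -ψ a b c) (h₂ : ∀ a b c, ψ a c b = -ψ a b c)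
    (f : Fin 4 → Fin 6) :
    (dual ν ⋏ β) (fun l => EuclideanSpace.single (f l) 1) =
      ∑ i, ν i * (wedgeBasisCoord ψ i (f 0) (f 1) (f 2) (f 3) : ℝ) := by
  have h3 : ∀ a b c, ψ b c a = ψ a b c := fun a b c => by rw [h₂, h₁, neg_neg]
  have h4 : ∀ a b c, ψ c b a = -ψ a b c := fun a b c => by rw [h₁, h3]
  have h5 : ∀ a b c, ψ c a b = ψ a b c := fun a b c => by rw [h₁, h₂, neg_neg]
  have hsum : ∑ i, ν i * (wedgeBasisCoord ψ i (f 0) (f 1) (f 2) (f 3) : ℝ) =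
      ν (f 0) * ψ (f 1) (f 2) (f 3) - ν (f 1) * ψ (f 0) (f 2) (f 3)
        + ν (f 2) * ψ (f 0) (f 1) (f 3) - ν (f 3) * ψ (f 0) (f 1) (f 2) := by
    simp [wedgeBasisCoord, mul_add, mul_sub, Finset.sum_add_distrib, Finset.sum_sub_distrib]
  rw [hsum]
  have h6 : ((Nat.factorial 3 : ℕ) : ℝ) = 6 := by norm_num [Nat.factorial]
  unfold Form.wedge
  simp only [hβ, Nat.reduceAdd, sum_perm_succ]
  simp [Fin.sum_univ_succ, dual, decomposeFin_symm_apply_two, decomposeFin_symm_apply_three,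
    Equiv.swap_apply_def, EuclideanSpace.inner_single_right, h6]
  have hperm (a b c : Fin 6) := And.intro (h₁ a b c) <| And.intro (h₂ a b c) <|
    And.intro (h3 a b c) <| And.intro (h4 a b c) (h5 a b c)
  simp only [hperm (f 0) (f 1) (f 2), hperm (f 0) (f 1) (f 3), hperm (f 0) (f 2) (f 3),
    hperm (f 1) (f 2) (f 3), Int.cast_neg]
  ring

theorem inner'_dual_wedge (μ ν : E6) (α β : Form 6 3) (φ ψ : Fin 6 → Fin 6 → Fin 6 → ℤ)
    (hα : ∀ f : Fin 3 → Fin 6,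
      α (fun l => EuclideanSpace.single (f l) 1) = (φ (f 0) (f 1) (f 2) : ℝ))
    (hβ : ∀ f : Fin 3 → Fin 6,
      β (fun l => EuclideanSpace.single (f l) 1) = (ψ (f 0) (f 1) (f 2) : ℝ))
    (h₁ : ∀ a b c, ψ b a c = -ψ a b c) (h₂ : ∀ a b c, ψ a c b = -ψ a b c) :
    Form.inner' (dual μ ⋏ α) (dual ν ⋏ β) = 6⁻¹ * ∑ a, ∑ i, μ a * ν i *
      ((∑ b, ∑ c, ∑ d, φ b c d * wedgeBasisCoord ψ i a b c d : ℤ) : ℝ) := by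
  rw [Form.inner'_wedge _ _ _ (Form.wedge_comp_perm _ _)]
  have e (F : (Fin 4 → Fin 6) → ℝ) : ∑ f, F f = ∑ a, ∑ b, ∑ c, ∑ d, F ![a, b, c, d] := by
    simp only [sum_fin_succ_arrow, Finset.univ_unique, Finset.sum_singleton]
    rfl
  rw [e]
  simp [dual, hα, dual_wedge_single ν β ψ hβ h₁ h₂, EuclideanSpace.inner_single_right]
  have h6 : ((Nat.factorial 3 : ℕ) : ℝ) = 6 := by norm_num [Nat.factorial]
  rw [h6]
  congr 1
  refine Finset.sum_congr rfl fun a _ => ?_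
  simp only [Finset.mul_sum]
  symm
  rw [Finset.sum_comm]
  refine Finset.sum_congr rfl fun b _ => ?_
  rw [Finset.sum_comm]
  refine Finset.sum_congr rfl fun c _ => ?_
  rw [Finset.sum_comm]
  refine Finset.sum_congr rfl fun d _ => Finset.sum_congr rfl fun i _ => ?_
  ring

theorem psipCoord_swap_left (a b c : Fin 6) : psipCoord b a c = -psipCoord a b c := by
  simp only [psipCoord, wedgeCoord]
  ring

theorem psipCoord_swap_right (a b c : Fin 6) : psipCoord a c b = -psipCoord a b c := by
  simp only [psipCoord, wedgeCoord]
  ring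

theorem psimCoord_swap_left (a b c : Fin 6) : psimCoord b a c = -psimCoord a b c := by
  simp only [psimCoord, wedgeCoord]
  ring

theorem psimCoord_swap_right (a b c : Fin 6) : psimCoord a c b = -psimCoord a b c := by
  simp only [psimCoord, wedgeCoord]
  ring

theorem sum_mul_wedgeBasisCoord (φ ψ : Fin 6 → Fin 6 → Fin 6 → ℤ) (i a : Fin 6) :
    ∑ b, ∑ c, ∑ d, φ b c d * wedgeBasisCoord ψ i a b c d =
      (if i = a then ∑ b, ∑ c, ∑ d, φ b c d * ψ b c d else 0)
        - ∑ c, ∑ d, φ i c d * ψ a c d + ∑ b, ∑ d, φ b i d * ψ a b d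
        - ∑ b, ∑ c, φ b c i * ψ a b c := by
  simp only [wedgeBasisCoord, mul_add, mul_sub, mul_ite, mul_zero, Finset.sum_add_distrib,
    Finset.sum_sub_distrib, Finset.sum_ite_eq, Finset.mem_univ, if_true]
  congr 3
  · split_ifs <;> simp
  · simp [Finset.sum_ite_irrel]
  · funext b
    rw [Finset.sum_comm]
    simp

theorem sum_mul_wedgeBasisCoord_of_alternating (φ ψ : Fin 6 → Fin 6 → Fin 6 → ℤ)
    (h₁ : ∀ a b c, φ b a c = -φ a b c) (h₂ : ∀ a b c, φ a c b = -φ a b c) (i a : Fin 6) :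
    ∑ b, ∑ c, ∑ d, φ b c d * wedgeBasisCoord ψ i a b c d =
      (if i = a then ∑ b, ∑ c, ∑ d, φ b c d * ψ b c d else 0)
        - 3 * ∑ c, ∑ d, φ i c d * ψ a c d := by
  rw [sum_mul_wedgeBasisCoord]
  have h₃ (b c : Fin 6) : φ b c i = φ i b c := by rw [h₂, h₁, neg_neg]
  simp only [h₃, h₁ i, neg_mul, Finset.sum_neg_distrib]
  ring

theorem contract_psipCoord_psipCoord : ∀ i a,
    ∑ c, ∑ d, psipCoord i c d * psipCoord a c d = if i = a then 4 else 0 := by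
  decide +kernel

theorem contract_psimCoord_psimCoord : ∀ i a,
    ∑ c, ∑ d, psimCoord i c d * psimCoord a c d = if i = a then 4 else 0 := by
  decide +kernel

theorem contract_psimCoord_psipCoord : ∀ i a,
    ∑ c, ∑ d, psimCoord i c d * psipCoord a c d =
      if i = a + 3 then (if a < 3 then 4 else -4) else 0 := by
  decide +kernel

/-- for all 1-forms `μ,ν` on ℝ⁶ (identified with vectors):
`⟨μ∧Ψ₊, ν∧Ψ₊⟩ = ⟨μ∧Ψ₋, ν∧Ψ₋⟩ = 2⟨μ,ν⟩` and `⟨μ∧Ψ₋, ν∧Ψ₊⟩ = −2⟨Jμ,ν⟩`. -/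
theorem stmt15 (μ ν : E6) :
    Form.inner' (dual μ ⋏ Psip) (dual ν ⋏ Psip) = 2 * ⟪μ, ν⟫ ∧
    Form.inner' (dual μ ⋏ Psim) (dual ν ⋏ Psim) = 2 * ⟪μ, ν⟫ ∧
    Form.inner' (dual μ ⋏ Psim) (dual ν ⋏ Psip) = -2 * ⟪J6 μ, ν⟫ := by
  rw [inner'_dual_wedge μ ν Psip Psip _ _ Psip_single Psip_single
      psipCoord_swap_left psipCoord_swap_right,
    inner'_dual_wedge μ ν Psim Psim _ _ Psim_single Psim_single
      psimCoord_swap_left psimCoord_swap_right,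
    inner'_dual_wedge μ ν Psim Psip _ _ Psim_single Psip_single
      psipCoord_swap_left psipCoord_swap_right]
  simp only [sum_mul_wedgeBasisCoord_of_alternating _ _ psipCoord_swap_left psipCoord_swap_right,
    sum_mul_wedgeBasisCoord_of_alternating _ _ psimCoord_swap_left psimCoord_swap_right,
    contract_psipCoord_psipCoord, contract_psimCoord_psimCoord, contract_psimCoord_psipCoord]
  refine ⟨?_, ?_, ?_⟩
  · simp [Fin.sum_univ_six, PiLp.inner_apply]
    ring
  · simp [Fin.sum_univ_six, PiLp.inner_apply]
    ring
  · simp [Fin.sum_univ_six, PiLp.inner_apply, J6, f6]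
    ring
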